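/- Let L be the Markov chain on ℤ with transition kernel Q(r,s) := P^r(0, s−r) for r ≥ 0 (where P^r is the r-step kernel of P and P⁰(0,z) = 1{z=0}), and let τ₀ := min{k ≥ 0 : L(k) ≤ 0}. Then for every δ > 0 there exists K_δ < ∞ such that for every r ∈ ℕ: E[τ₀ | L(0) = r] ≤ (2+δ)·r + K_δ. In particular τ₀ < ∞ almost surely from every starting point r ∈ ℕ. -/

import Mathlib

open MeasureTheory Filter
open scoped BigOperators ENNReal

noncomputable section

/-- `p(x) = w(-x)/(w(x)+w(-x))`. -/
def pfun (w : ℤ → ℝ) (x : ℤ) : ℝ := w (-x) / (w x + w (-x))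

/-- `q(x) = w(x)/(w(x)+w(-x))`. -/
def qfun (w : ℤ → ℝ) (x : ℤ) : ℝ := w x / (w x + w (-x))

/-- The Markov transition kernel `P(x,y)`. -/
def Pker (w : ℤ → ℝ) (x y : ℤ) : ℝ :=
  if x - 1 ≤ y then (∏ z ∈ Finset.Icc x y, pfun w z) * qfun w (y + 1) else 0

/-- The `m`-step transition kernel. -/
def Pm (w : ℤ → ℝ) : ℕ → ℤ → ℤ → ℝ
  | 0, x, y => if x = y then 1 else 0
  | m + 1, x, y => ∑' z : ℤ, Pm w m x z * Pker w z y

/-- The normalizing constant `Z`. -/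
def Zconst (w : ℤ → ℝ) : ℝ :=
  2 * ∑' x : ℕ, ∏ z ∈ Finset.Icc (1 : ℤ) (x : ℤ), w (-z) / w z

/-- The stationary distribution `ρ`. -/
def rho (w : ℤ → ℝ) (x : ℤ) : ℝ :=
  (Zconst w)⁻¹ * ∏ z ∈ Finset.Icc (1 : ℤ) (|2 * x + 1| / 2), w (-z) / w z

/-- The weight function `w` is positive, nondecreasing and satisfies
`lim_{z→∞} (w(z) - w(-z)) > 0`. -/
def GoodWeight (w : ℤ → ℝ) : Prop :=
  (∀ z, 0 < w z) ∧ (∀ z, w z ≤ w (z + 1)) ∧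
    ∃ c > (0 : ℝ), ∀ᶠ z : ℤ in atTop, c ≤ w z - w (-z)

/-- `η` is a Markov chain with (sub)stochastic kernel `K` started at `a`,
characterized through its cylinder probabilities. -/
def KChain {Ω : Type*} [MeasurableSpace Ω] (μ : Measure Ω)
    (K : ℤ → ℤ → ℝ) (η : ℕ → Ω → ℤ) (a : ℤ) : Prop :=
  (∀ n, Measurable (η n)) ∧
  ∀ (n : ℕ) (x : ℕ → ℤ),
    μ {ω | ∀ i ≤ n, η i ω = x i} =
      ENNReal.ofReal ((if x 0 = a then (1 : ℝ) else 0) *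
        ∏ i ∈ Finset.range n, K (x i) (x (i + 1)))

/-- The kernel `Q(r,s) := P^r(0, s - r)` for `r ≥ 0` (absorbing at negative states,
which are never used since the chain is stopped at `τ₀`). -/
def Qker (w : ℤ → ℝ) (r s : ℤ) : ℝ :=
  if 0 ≤ r then Pm w r.toNat 0 (s - r) else if s = r then 1 else 0


/-- Probability of `k` consecutive up-steps from `x`. -/
def upProd (p : ℤ → ℝ≥0∞) (x : ℤ) (k : ℕ) : ℝ≥0∞ := ∏ i ∈ Finset.range k, p (x + i)

/-- Action on functions of the kernel that climbs from `x` with up-probabilities `p` and stops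
after the first down-step. -/
def stepOp (p q : ℤ → ℝ≥0∞) (g : ℤ → ℝ≥0∞) (x : ℤ) : ℝ≥0∞ :=
  ∑' k : ℕ, upProd p x k * q (x + k) * g (x - 1 + k)

/-- The operator controlling the increments of `stepOp p q g` by those of `g`. -/
def diffOp (p q : ℤ → ℝ≥0∞) (c : ℤ → ℝ≥0∞) (x : ℤ) : ℝ≥0∞ :=
  q (x - 1) * ∑' k : ℕ, upProd p x k * c (x - 1 + k)

/-- Up- and down-probabilities of a walk reflected symmetrically with a strict drift towards the
origin far away. -/
structure UpDown (p q : ℤ → ℝ≥0∞) : Prop where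
  add_eq_one : ∀ x, p x + q x = 1
  symm : ∀ x, p (-x) = q x
  antitone : Antitone p
  pos : ∀ x, p x ≠ 0
  drift : ∃ κ : ℝ≥0∞, κ < 1 / 2 ∧ ∃ N : ℕ, ∀ n : ℕ, N ≤ n → p n ≤ κ

section Operators

variable {p q : ℤ → ℝ≥0∞}

theorem upProd_zero (x : ℤ) : upProd p x 0 = 1 := by simp [upProd]

theorem upProd_succ (x : ℤ) (k : ℕ) : upProd p x (k + 1) = upProd p x k * p (x + k) := by
  simp [upProd, Finset.prod_range_succ]

theorem upProd_succ' (x : ℤ) (k : ℕ) : upProd p x (k + 1) = p x * upProd p (x + 1) k := by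
  simp only [upProd, Finset.prod_range_succ']
  rw [mul_comm]
  simp [add_assoc, add_comm (1 : ℤ)]

theorem UpDown.le_one (h : UpDown p q) (x : ℤ) : p x ≤ 1 := by
  rw [← h.add_eq_one x]; exact le_self_add

theorem UpDown.le_one' (h : UpDown p q) (x : ℤ) : q x ≤ 1 := by
  rw [← h.add_eq_one x]; exact le_add_self

theorem UpDown.ne_top (h : UpDown p q) (x : ℤ) : p x ≠ ⊤ :=
  ne_top_of_le_ne_top ENNReal.one_ne_top (h.le_one x)

theorem UpDown.ne_top' (h : UpDown p q) (x : ℤ) : q x ≠ ⊤ :=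
  ne_top_of_le_ne_top ENNReal.one_ne_top (h.le_one' x)

theorem UpDown.pos' (h : UpDown p q) (x : ℤ) : q x ≠ 0 := by
  rw [← h.symm x]; exact h.pos _

theorem UpDown.monotone (h : UpDown p q) : Monotone q := by
  intro x y hxy
  rw [← h.symm x, ← h.symm y]
  exact h.antitone (neg_le_neg hxy)

theorem UpDown.zero_eq (h : UpDown p q) : p 0 = q 0 := by simpa using h.symm 0

theorem UpDown.le_half (h : UpDown p q) {x : ℤ} (hx : 0 ≤ x) : p x ≤ 1 / 2 := by
  refine (h.antitone hx).trans ?_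
  have h1 := h.add_eq_one 0
  rw [← h.zero_eq, ← two_mul] at h1
  rw [ENNReal.le_div_iff_mul_le (by simp) (by simp), mul_comm, h1]

theorem stepOp_eq (g : ℤ → ℝ≥0∞) (x : ℤ) :
    stepOp p q g x = q x * g (x - 1) + p x * stepOp p q g (x + 1) := by
  unfold stepOp
  rw [tsum_eq_zero_add' ENNReal.summable, ← ENNReal.tsum_mul_left]
  congr 1
  · simp [upProd_zero]
  · refine tsum_congr fun k => ?_
    rw [upProd_succ', show x + ((k + 1 : ℕ) : ℤ) = x + 1 + k by push_cast; ring,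
      show x - 1 + ((k + 1 : ℕ) : ℤ) = x + 1 - 1 + k by push_cast; ring]
    ring

theorem sum_by_parts (h : UpDown p q) (x : ℤ) (H c : ℕ → ℝ≥0∞)
    (hH : ∀ n, H (n + 1) = H n + c n) (n : ℕ) :
    ∑ k ∈ Finset.range n, upProd p x k * q (x + k) * H (k + 1) + upProd p x n * H n =
      H 0 + ∑ j ∈ Finset.range n, upProd p x j * c j := by
  induction n with
  | zero => simp [upProd_zero]
  | succ n ih =>
    rw [Finset.sum_range_succ, Finset.sum_range_succ, ← add_assoc, ← ih, upProd_succ]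
    calc _ = ∑ k ∈ Finset.range n, upProd p x k * q (x + k) * H (k + 1)
          + upProd p x n * H (n + 1) * (p (x + n) + q (x + n)) := by ring
      _ = _ := by rw [h.add_eq_one, hH]; ring

theorem tendsto_upProd (h : UpDown p q) (x : ℤ) :
    Tendsto (upProd p x) atTop (nhds 0) := by
  have key : ∀ k : ℕ, upProd p x (k + x.natAbs) ≤ (1 / 2) ^ k := by
    intro k
    induction k with
    | zero =>
      simp only [upProd, pow_zero]
      exact Finset.prod_le_one' fun i _ => h.le_one _
    | succ k ih =>
      rw [show k + 1 + x.natAbs = k + x.natAbs + 1 by ring, upProd_succ, pow_succ]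
      exact mul_le_mul' ih (h.le_half (by omega))
  rw [← tendsto_add_atTop_iff_nat x.natAbs]
  refine tendsto_of_tendsto_of_tendsto_of_le_of_le tendsto_const_nhds
    (ENNReal.tendsto_pow_atTop_nhds_zero_of_lt_one ?_) (fun _ => zero_le) key
  simp

theorem tsum_upProd (h : UpDown p q) (x : ℤ) :
    ∑' k : ℕ, upProd p x k * q (x + k) = 1 := by
  have h1 := fun n => sum_by_parts h x (fun _ => 1) (fun _ => 0) (by simp) n
  simp only [mul_one, mul_zero, Finset.sum_const_zero, add_zero] at h1
  have h2 := (ENNReal.summable.hasSum (f := fun k : ℕ => upProd p x k * q (x + k))).tendsto_sum_nat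
  have h3 := h2.add (tendsto_upProd h x)
  simp only [h1, add_zero] at h3
  exact (tendsto_nhds_unique h3 tendsto_const_nhds)

theorem stepOp_const (h : UpDown p q) (a : ℝ≥0∞) : stepOp p q (fun _ => a) = fun _ => a := by
  ext x
  simp only [stepOp]
  rw [ENNReal.tsum_mul_right, tsum_upProd h, one_mul]

theorem monotone_stepOp (h : UpDown p q) {g : ℤ → ℝ≥0∞} (hg : Monotone g) :
    Monotone (stepOp p q g) := by
  refine monotone_int_of_le_succ fun x => ?_
  have h1 : g (x - 1) ≤ stepOp p q g (x + 1) := by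
    calc g (x - 1) = stepOp p q (fun _ => g (x - 1)) (x + 1) := by rw [stepOp_const h]
      _ ≤ _ := ENNReal.tsum_le_tsum fun k => mul_le_mul_right (hg (by omega)) _
  rw [stepOp_eq]
  calc _ ≤ q x * stepOp p q g (x + 1) + p x * stepOp p q g (x + 1) := by gcongr
    _ = (p x + q x) * stepOp p q g (x + 1) := by ring
    _ = _ := by rw [h.add_eq_one, one_mul]

theorem stepOp_le_add_diffOp (h : UpDown p q) {g c : ℤ → ℝ≥0∞}
    (hg : ∀ x, g x ≤ g (x - 1) + c x) (x : ℤ) :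
    stepOp p q g x ≤ stepOp p q g (x - 1) + diffOp p q c x := by
  have h1 : stepOp p q g x ≤ g (x - 2) + ∑' k : ℕ, upProd p x k * c (x - 1 + k) := by
    set H : ℕ → ℝ≥0∞ := fun n => g (x - 2) + ∑ j ∈ Finset.range n, c (x - 1 + j) with hH
    have hle : ∀ k : ℕ, g (x - 1 + k) ≤ H (k + 1) := by
      intro k
      induction k with
      | zero => simpa [hH, show x - 1 - 1 = x - 2 by ring] using hg (x - 1)
      | succ k ih =>
        have := hg (x - 1 + (k + 1 : ℕ))
        rw [show x - 1 + ((k + 1 : ℕ) : ℤ) - 1 = x - 1 + k by push_cast; ring] at this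
        refine this.trans ?_
        have e : H (k + 1 + 1) = H (k + 1) + c (x - 1 + (k + 1 : ℕ)) := by
          simp only [hH]; rw [Finset.sum_range_succ _ (k + 1), add_assoc]
        rw [e]
        gcongr
    refine ENNReal.tsum_le_of_sum_range_le fun n => ?_
    have h2 := sum_by_parts h x H (fun n => c (x - 1 + n))
      (fun n => by simp only [hH]; rw [Finset.sum_range_succ, add_assoc]) n
    calc _ ≤ ∑ k ∈ Finset.range n, upProd p x k * q (x + k) * H (k + 1) := by
          gcongr; exact hle _
      _ ≤ _ := le_self_add
      _ = _ := h2
      _ ≤ _ := by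
        simp only [hH, Finset.range_zero, Finset.sum_empty, add_zero]
        gcongr
        exact ENNReal.sum_le_tsum _
  rw [stepOp_eq g (x - 1), diffOp, show x - 1 - 1 = x - 2 by ring, sub_add_cancel]
  calc stepOp p q g x = (p (x - 1) + q (x - 1)) * stepOp p q g x := by
        rw [h.add_eq_one, one_mul]
    _ = q (x - 1) * stepOp p q g x + p (x - 1) * stepOp p q g x := by ring
    _ ≤ q (x - 1) * (g (x - 2) + ∑' k : ℕ, upProd p x k * c (x - 1 + k))
        + p (x - 1) * stepOp p q g x := by gcongr
    _ = _ := by ring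

theorem diffOp_mono {c d : ℤ → ℝ≥0∞} (hcd : c ≤ d) : diffOp p q c ≤ diffOp p q d :=
  fun _ => mul_le_mul_right (ENNReal.tsum_le_tsum fun _ => mul_le_mul_right (hcd _) _) _

theorem diffOp_one_le (h : UpDown p q) : diffOp p q 1 ≤ 1 := by
  intro x
  have h1 : ∑' k : ℕ, upProd p x k * (1 : ℤ → ℝ≥0∞) (x - 1 + k) ≤ (q x)⁻¹ := by
    have : q x = 1 - p x := by
      rw [← h.add_eq_one x]; exact (ENNReal.add_sub_cancel_left (h.ne_top x)).symm
    rw [this, ← ENNReal.tsum_geometric]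
    refine ENNReal.tsum_le_tsum fun k => ?_
    simp only [Pi.one_apply, mul_one, upProd]
    calc _ ≤ ∏ i ∈ Finset.range k, p x := Finset.prod_le_prod' fun i _ => h.antitone (by omega)
      _ = _ := by simp
  calc diffOp p q 1 x ≤ q x * (q x)⁻¹ := by
        unfold diffOp
        gcongr
        exact h.monotone (by omega)
    _ = 1 := ENNReal.mul_inv_cancel (h.pos' x) (h.ne_top' x)

/-- The recurrence relating consecutive iterates of `diffOp`. -/
theorem diffOp_recurrence (c : ℤ → ℝ≥0∞) (x : ℤ) :
    q x * diffOp p q c x =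
      q (x - 1) * (q x * c (x - 1) + p x * diffOp p q c (x + 1)) := by
  unfold diffOp
  rw [tsum_eq_zero_add' ENNReal.summable]
  have : ∑' k : ℕ, upProd p x (k + 1) * c (x - 1 + (k + 1 : ℕ)) =
      p x * ∑' k : ℕ, upProd p (x + 1) k * c (x + 1 - 1 + k) := by
    rw [← ENNReal.tsum_mul_left]
    refine tsum_congr fun k => ?_
    rw [upProd_succ', show x - 1 + ((k + 1 : ℕ) : ℤ) = x + 1 - 1 + k by push_cast; ring]
    ring
  rw [this, upProd_zero, add_sub_cancel_right]
  simp only [Nat.cast_zero, add_zero]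
  ring

theorem antitone_iterate_diffOp (h : UpDown p q) :
    Antitone fun r : ℕ => (diffOp p q)^[r] 1 := by
  refine antitone_nat_of_succ_le fun r => ?_
  rw [Function.iterate_succ_apply]
  exact (show Monotone (diffOp p q) from fun _ _ => diffOp_mono).iterate r (diffOp_one_le h)

theorem iterate_stepOp_le (h : UpDown p q) {g : ℤ → ℝ≥0∞} (hg : ∀ x, g x ≤ g (x - 1) + 1)
    (r : ℕ) (x : ℤ) :
    (stepOp p q)^[r] g x ≤ (stepOp p q)^[r] g (x - 1) + (diffOp p q)^[r] 1 x := by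
  induction r generalizing x with
  | zero => simpa using hg x
  | succ r ih =>
    rw [Function.iterate_succ_apply', Function.iterate_succ_apply']
    exact stepOp_le_add_diffOp h ih x

theorem monotone_iterate_stepOp (h : UpDown p q) {g : ℤ → ℝ≥0∞} (hg : Monotone g) (r : ℕ) :
    Monotone ((stepOp p q)^[r] g) := by
  induction r with
  | zero => exact hg
  | succ r ih => rw [Function.iterate_succ_apply']; exact monotone_stepOp h ih

theorem iterate_stepOp_zero_le (h : UpDown p q) {g : ℤ → ℝ≥0∞} (hg : ∀ x, g x ≤ g (x - 1) + 1)
    (r k : ℕ) :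
    (stepOp p q)^[r] g 0 ≤ (stepOp p q)^[r] g (Int.negSucc k) +
      ∑ j ∈ Finset.range (k + 1), (diffOp p q)^[r] 1 (-j) := by
  induction k with
  | zero => simpa using iterate_stepOp_le h hg r 0
  | succ k ih =>
    refine ih.trans ?_
    rw [Finset.sum_range_succ _ (k + 1), add_comm (∑ j ∈ Finset.range (k + 1), _), ← add_assoc]
    gcongr
    have := iterate_stepOp_le h hg r (Int.negSucc k)
    rwa [show Int.negSucc k - 1 = Int.negSucc (k + 1) by omega,
      show Int.negSucc k = -((k + 1 : ℕ) : ℤ) by rfl] at this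

end Operators

theorem false_of_geometric_growth {a : ℕ → ℝ} {κ : ℝ} (hκ0 : 0 < κ) (hκ : κ < 1 / 2)
    (h0 : 0 < a 0) (hstep : ∀ n, (1 - κ) * a n ≤ κ * a (n + 1)) (hb : ∀ n, a n ≤ 1) : False := by
  have hl : 1 < (1 - κ) / κ := by rw [lt_div_iff₀ hκ0]; linarith
  have hge : ∀ n, ((1 - κ) / κ) ^ n * a 0 ≤ a n := by
    intro n
    induction n with
    | zero => simp
    | succ n ih =>
      calc ((1 - κ) / κ) ^ (n + 1) * a 0 = (1 - κ) / κ * (((1 - κ) / κ) ^ n * a 0) := by ring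
        _ ≤ (1 - κ) / κ * a n := by gcongr
        _ ≤ a (n + 1) := by
          rw [div_mul_eq_mul_div, div_le_iff₀ hκ0]; linarith [hstep n]
  obtain ⟨n, hn⟩ := pow_unbounded_of_one_lt (1 / a 0) hl
  rw [div_lt_iff₀ h0] at hn
  linarith [hge n, hb n]

/-- A bounded nonnegative solution of the recurrence satisfied by fixed points of `diffOp`
vanishes. -/
theorem eq_zero_of_recurrence {q d : ℤ → ℝ} {κ : ℝ} (hκ : κ < 1 / 2) {N : ℤ}
    (hq : Monotone q) (hq0 : ∀ x, 0 < q x) (hq1 : ∀ x, q x < 1) (hq2 : q 0 = 1 / 2)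
    (hr : ∀ x, N ≤ x → 1 - κ ≤ q x) (hl : ∀ x, x ≤ -N → q x ≤ κ)
    (hd0 : ∀ x, 0 ≤ d x) (hd1 : ∀ x, d x ≤ 1)
    (hrec : ∀ x, q x * d x = q (x - 1) * (q x * d (x - 1) + (1 - q x) * d (x + 1))) (x : ℤ) :
    d x = 0 := by
  have hκ0 : 0 < κ := (hq0 (-N)).trans_le (hl _ le_rfl)
  obtain ⟨u, hu⟩ : ∃ u : ℤ → ℝ, ∀ x, d x = q (x - 1) * u x :=
    ⟨fun x => d x / q (x - 1), fun x => by field_simp [(hq0 (x - 1)).ne']⟩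
  have hu0 : ∀ x, 0 ≤ u x := fun x => by
    have := hd0 x
    rw [hu] at this
    exact nonneg_of_mul_nonneg_right this (hq0 _)
  have hurec : ∀ x, u x = q (x - 2) * u (x - 1) + (1 - q x) * u (x + 1) := by
    intro x
    have := hrec x
    rw [hu x, hu (x - 1), hu (x + 1), add_sub_cancel_right, show x - 1 - 1 = x - 2 by ring] at this
    apply mul_left_cancel₀ (mul_pos (hq0 x) (hq0 (x - 1))).ne'
    linear_combination this
  set v : ℤ → ℝ := fun x => q (x - 2) * (u x - u (x - 1)) with hv
  have hvrec : ∀ x, (1 - q x) * v (x + 1) = q (x - 1) * (v x + (q x - q (x - 2)) * u x) := by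
    intro x
    simp only [hv, add_sub_cancel_right, show x + 1 - 2 = x - 1 by ring]
    linear_combination (-q (x - 1)) * hurec x
  have hkill : ∀ x, 0 ≤ (q x - q (x - 2)) * u x := fun x =>
    mul_nonneg (sub_nonneg.2 (hq (by omega))) (hu0 x)
  have hv1 : ∀ x, v x ≤ 1 := by
    intro x
    have h1 : q (x - 2) * u x ≤ q (x - 1) * u x :=
      mul_le_mul_of_nonneg_right (hq (by omega)) (hu0 x)
    have h2 := mul_nonneg (hq0 (x - 2)).le (hu0 (x - 1))
    have h3 := hd1 x
    rw [hu] at h3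
    simp only [hv]
    linarith
  have hv2 : ∀ x, -v x ≤ 1 := by
    intro x
    have h1 := mul_nonneg (hq0 (x - 2)).le (hu0 x)
    have h3 := hd1 (x - 1)
    rw [hu, show x - 1 - 1 = x - 2 by ring] at h3
    simp only [hv]
    linarith
  have hright : ∀ x, v x ≤ 0 := by
    by_contra! hcon
    obtain ⟨x0, hx0⟩ := hcon
    have hpos : ∀ n : ℕ, 0 < v (x0 + n) := by
      intro n
      induction n with
      | zero => simpa using hx0
      | succ n ih =>
        have h1 := hvrec (x0 + n)
        have h2 : 0 < q (x0 + n - 1) * (v (x0 + n) +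
            (q (x0 + n) - q (x0 + n - 2)) * u (x0 + n)) :=
          mul_pos (hq0 _) (by linarith [hkill (x0 + n)])
        rw [← h1] at h2
        have := pos_of_mul_pos_right h2 (by linarith [hq1 (x0 + n)])
        rwa [show x0 + ((n + 1 : ℕ) : ℤ) = x0 + n + 1 by push_cast; ring]
    obtain ⟨m, hm⟩ : ∃ m : ℕ, N + 1 ≤ x0 + m := ⟨(N + 1 - x0).toNat, by omega⟩
    refine false_of_geometric_growth (a := fun n : ℕ => v (x0 + (m + n : ℕ))) hκ0 hκ (hpos _)
      (fun n => ?_) fun n => hv1 _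
    have h1 := hvrec (x0 + (m + n : ℕ))
    have h2 := hpos (m + n)
    have h3 := hpos (m + (n + 1))
    rw [show x0 + ((m + (n + 1) : ℕ) : ℤ) = x0 + (m + n : ℕ) + 1 by push_cast; ring] at h3
    simp only [show x0 + ((m + (n + 1) : ℕ) : ℤ) = x0 + (m + n : ℕ) + 1 by push_cast; ring]
    set y := x0 + ((m + n : ℕ) : ℤ)
    have hy : N + 1 ≤ y := by push_cast [y]; omega
    calc (1 - κ) * v y ≤ q (y - 1) * (v y + (q y - q (y - 2)) * u y) :=
          mul_le_mul (hr _ (by omega)) (by linarith [hkill y]) h2.le (hq0 _).le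
      _ = (1 - q y) * v (y + 1) := h1.symm
      _ ≤ _ := mul_le_mul_of_nonneg_right (by linarith [hr y (by omega)]) h3.le
  have hleft : ∀ x, 0 ≤ v x := by
    by_contra! hcon
    obtain ⟨x0, hx0⟩ := hcon
    have hstep : ∀ x, v x < 0 → q (x - 2) * v (x - 1) ≤ (1 - q (x - 1)) * v x := by
      intro x hx
      have h1 := hvrec (x - 1)
      rw [sub_add_cancel, show x - 1 - 1 = x - 2 by ring] at h1
      rw [h1]
      exact mul_le_mul_of_nonneg_left (by linarith [hkill (x - 1)]) (hq0 _).le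
    have hneg : ∀ n : ℕ, v (x0 - n) < 0 := by
      intro n
      induction n with
      | zero => simpa using hx0
      | succ n ih =>
        rw [show x0 - ((n + 1 : ℕ) : ℤ) = x0 - n - 1 by push_cast; ring]
        by_contra! hc
        have h1 := hstep _ ih
        have h2 := mul_nonneg (hq0 (x0 - n - 2)).le hc
        have h3 := mul_neg_of_pos_of_neg (show 0 < 1 - q (x0 - n - 1) by
          linarith [hq1 (x0 - n - 1)]) ih
        linarith
    obtain ⟨m, hm⟩ : ∃ m : ℕ, x0 - m ≤ -N := ⟨(N + x0).toNat, by omega⟩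
    refine false_of_geometric_growth (a := fun n : ℕ => -v (x0 - (m + n : ℕ))) hκ0 hκ
      (neg_pos.2 (hneg _)) (fun n => ?_) fun n => hv2 _
    have h2 := hneg (m + n)
    have h3 := hneg (m + (n + 1))
    simp only [show x0 - ((m + (n + 1) : ℕ) : ℤ) = x0 - (m + n : ℕ) - 1 by push_cast; ring]
      at h3 ⊢
    set y := x0 - ((m + n : ℕ) : ℤ)
    have hy : y ≤ -N := by push_cast [y]; omega
    have h1 := hstep y h2
    have h4 : q (y - 2) * -v (y - 1) ≤ κ * -v (y - 1) :=
      mul_le_mul_of_nonneg_right (hl _ (by omega)) (by linarith)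
    have h5 : (1 - κ) * -v y ≤ (1 - q (y - 1)) * -v y :=
      mul_le_mul_of_nonneg_right (by linarith [hl (y - 1) (by omega)]) (by linarith)
    linarith
  have hconst : ∀ x, u (x + 1) = u x := by
    intro x
    have h1 : v (x + 1) = 0 := le_antisymm (hright _) (hleft _)
    simp only [hv, add_sub_cancel_right, mul_eq_zero, (hq0 _).ne', false_or] at h1
    linarith
  have hk0 : ∀ x, (q x - q (x - 2)) * u x = 0 := by
    intro x
    have h1 := hvrec x
    rw [le_antisymm (hright x) (hleft x), le_antisymm (hright (x + 1)) (hleft (x + 1)),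
      mul_zero, zero_add] at h1
    exact (mul_eq_zero.1 h1.symm).resolve_left (hq0 _).ne'
  have huc : ∀ x, u x = u 0 := by
    intro x
    induction x using Int.induction_on with
    | zero => rfl
    | succ n ih => rw [hconst, ih]
    | pred n ih => rw [← ih, ← hconst, sub_add_cancel]
  rw [hu, huc x]
  by_contra hne
  have hu1 : u 0 ≠ 0 := right_ne_zero_of_mul hne
  have hqc : ∀ n : ℕ, q (2 * n) = q 0 := by
    intro n
    induction n with
    | zero => simp
    | succ n ih =>
      have h1 := hk0 (2 * (n + 1 : ℕ))
      rw [huc] at h1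
      have h2 := (mul_eq_zero.1 h1).resolve_right hu1
      rw [show (2 * ((n + 1 : ℕ) : ℤ)) - 2 = 2 * n by push_cast; ring, ih] at h2
      linarith
  have h1 := hqc N.natAbs
  have h2 := hr (2 * N.natAbs) (by omega)
  linarith

section Stationary

variable {p q : ℤ → ℝ≥0∞}

theorem iterate_diffOp_le_one (h : UpDown p q) (r : ℕ) (x : ℤ) : (diffOp p q)^[r] 1 x ≤ 1 :=
  antitone_iterate_diffOp h (Nat.zero_le r) x

theorem tendsto_iterate_diffOp (h : UpDown p q) (x : ℤ) :
    Tendsto (fun r : ℕ => (diffOp p q)^[r] 1 x) atTop (nhds 0) := by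
  set D : ℤ → ℝ≥0∞ := fun x => ⨅ r : ℕ, (diffOp p q)^[r] 1 x with hD
  have hlim : ∀ x, Tendsto (fun r : ℕ => (diffOp p q)^[r] 1 x) atTop (nhds (D x)) := fun x =>
    tendsto_atTop_iInf fun r s hrs => antitone_iterate_diffOp h hrs x
  have hD1 : ∀ x, D x ≤ 1 := fun x => (iInf_le _ 0).trans (by simp)
  have hDt : ∀ x, D x ≠ ⊤ := fun x => ne_top_of_le_ne_top ENNReal.one_ne_top (hD1 x)
  have hDrec : ∀ x, q x * D x = q (x - 1) * (q x * D (x - 1) + p x * D (x + 1)) := by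
    intro x
    have hs : ∀ y, Tendsto (fun r : ℕ => (diffOp p q)^[r + 1] 1 y) atTop (nhds (D y)) :=
      fun y => (tendsto_add_atTop_iff_nat 1).2 (hlim y)
    refine tendsto_nhds_unique
      (ENNReal.Tendsto.const_mul (hs x) (Or.inr (h.ne_top' x))) ?_
    have h1 := ENNReal.Tendsto.const_mul
      ((ENNReal.Tendsto.const_mul (hlim (x - 1)) (Or.inr (h.ne_top' x))).add
        (ENNReal.Tendsto.const_mul (hs (x + 1)) (Or.inr (h.ne_top x))))
      (Or.inr (h.ne_top' (x - 1)))
    refine h1.congr fun r => ?_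
    rw [Function.iterate_succ_apply']
    exact (diffOp_recurrence _ x).symm
  obtain ⟨κ, hκ, N, hN⟩ := h.drift
  have hκt : κ ≠ ⊤ := ne_top_of_lt hκ
  have hpr : ∀ x, (p x).toReal = 1 - (q x).toReal := by
    intro x
    have := congrArg ENNReal.toReal (h.add_eq_one x)
    rw [ENNReal.toReal_add (h.ne_top x) (h.ne_top' x), ENNReal.toReal_one] at this
    linarith
  have hN' : ∀ x : ℤ, (N : ℤ) ≤ x → (p x).toReal ≤ κ.toReal := by
    intro x hx
    lift x to ℕ using by omega
    exact ENNReal.toReal_mono hκt (hN x (by omega))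
  have hz := eq_zero_of_recurrence (q := fun x => (q x).toReal) (d := fun x => (D x).toReal)
    (κ := κ.toReal) (N := N) ?_ ?_ ?_ ?_ ?_ ?_ ?_ ?_ ?_ ?_ x
  · have := hlim x
    rwa [(ENNReal.toReal_eq_zero_iff _).1 hz |>.resolve_right (hDt x)] at this
  · have := (ENNReal.toReal_lt_toReal hκt (by simp)).2 hκ
    simpa using this
  · exact fun x y hxy => ENNReal.toReal_mono (h.ne_top' y) (h.monotone hxy)
  · exact fun x => ENNReal.toReal_pos (h.pos' x) (h.ne_top' x)
  · intro x
    have := ENNReal.toReal_pos (h.pos x) (h.ne_top x)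
    rw [hpr] at this
    linarith
  · have := hpr 0
    rw [h.zero_eq] at this
    linarith
  · intro x hx
    have := hN' x hx
    rw [hpr] at this
    linarith
  · intro x hx
    rw [← h.symm x]
    exact hN' _ (by omega)
  · exact fun x => ENNReal.toReal_nonneg
  · intro x
    simpa using ENNReal.toReal_mono ENNReal.one_ne_top (hD1 x)
  · intro x
    have := congrArg ENNReal.toReal (hDrec x)
    rw [ENNReal.toReal_mul, ENNReal.toReal_mul,
      ENNReal.toReal_add (ENNReal.mul_ne_top (h.ne_top' _) (hDt _))
        (ENNReal.mul_ne_top (h.ne_top _) (hDt _)), ENNReal.toReal_mul, ENNReal.toReal_mul,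
      hpr] at this
    exact this

/-- Unnormalized stationary weights on the nonnegative half-line. -/
def statWeight (p q : ℤ → ℝ≥0∞) (n : ℕ) : ℝ≥0∞ :=
  ∏ i ∈ Finset.range n, p (i + 1) / q (i + 1)

/-- Unnormalized stationary weights, symmetric around `-1/2`. -/
def statMeasure (p q : ℤ → ℝ≥0∞) : ℤ → ℝ≥0∞
  | Int.ofNat n => statWeight p q n
  | Int.negSucc n => statWeight p q n

theorem statWeight_succ (h : UpDown p q) (n : ℕ) :
    statWeight p q (n + 1) * q (n + 1) = statWeight p q n * p (n + 1) := by
  simp only [statWeight, Finset.prod_range_succ]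
  rw [mul_assoc, ENNReal.div_mul_cancel (h.pos' _) (h.ne_top' _)]

theorem statWeight_ne_top (h : UpDown p q) (n : ℕ) : statWeight p q n ≠ ⊤ :=
  ENNReal.prod_ne_top fun _ _ => ENNReal.div_ne_top (h.ne_top _) (h.pos' _)

theorem statMeasure_balance (h : UpDown p q) (x : ℤ) :
    statMeasure p q x * q x = statMeasure p q (x - 1) * p x := by
  rcases x with (_ | n) | n
  · show statWeight p q 0 * q 0 = statWeight p q 0 * p 0
    rw [h.zero_eq]
  · have := statWeight_succ h n
    rw [show Int.ofNat (n + 1) - 1 = Int.ofNat n by simp]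
    exact this
  · have := statWeight_succ h n
    have e1 : p (Int.negSucc n) = q (n + 1) := by
      rw [← h.symm]; congr 1
    have e2 : q (Int.negSucc n) = p (n + 1) := by
      rw [← h.symm]; congr 1
    rw [show Int.negSucc n - 1 = Int.negSucc (n + 1) by omega, e1, e2]
    exact this.symm

theorem tsum_statMeasure (f : ℤ → ℝ≥0∞) :
    ∑' x, statMeasure p q x * f x =
      ∑' n : ℕ, statWeight p q n * (f n + f (Int.negSucc n)) := by
  rw [tsum_of_nat_of_neg_add_one ENNReal.summable ENNReal.summable, ← ENNReal.tsum_add]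
  refine tsum_congr fun n => ?_
  rw [mul_add, show -((n : ℤ) + 1) = Int.negSucc n by omega]
  rfl

theorem upProd_sub (y : ℤ) (k : ℕ) :
    upProd p (y + 1 - k) k = ∏ i ∈ Finset.range k, p (y - i) := by
  rw [upProd, ← Finset.prod_range_reflect]
  refine Finset.prod_congr rfl fun i hi => ?_
  rw [Finset.mem_range] at hi
  congr 1
  omega

theorem sum_statMeasure_upProd_le (h : UpDown p q) (y : ℤ) (n : ℕ) :
    ∑ k ∈ Finset.range n, statMeasure p q (y + 1 - k) * upProd p (y + 1 - k) k * q (y + 1) ≤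
      statMeasure p q y := by
  set m := statMeasure p q
  have hbal : ∀ x, m (x + 1) * q (x + 1) * q x + m (x - 1) * p x * q (x + 1) = m x * q x := by
    intro x
    have h1 := statMeasure_balance h (x + 1)
    have h2 := statMeasure_balance h x
    rw [add_sub_cancel_right] at h1
    calc m (x + 1) * q (x + 1) * q x + m (x - 1) * p x * q (x + 1)
        = m x * p (x + 1) * q x + m x * q x * q (x + 1) := by rw [h1, h2]
      _ = m x * q x * (p (x + 1) + q (x + 1)) := by ring
      _ = m x * q x := by rw [h.add_eq_one, mul_one]
  have hbal' : ∀ x, m x / q (x + 1) = m (x + 1) + p x * (m (x - 1) / q x) := by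
    intro x
    have h1 : m x * q x / q (x + 1) / q x = m x / q (x + 1) := by
      rw [mul_comm (m x), mul_div_assoc, mul_comm, ENNReal.mul_div_cancel_right (h.pos' _)
        (h.ne_top' _)]
    rw [← h1, ← hbal x, ENNReal.add_div, ENNReal.add_div, mul_right_comm,
      ENNReal.mul_div_cancel_right (h.pos' _) (h.ne_top' _),
      ENNReal.mul_div_cancel_right (h.pos' _) (h.ne_top' _),
      ENNReal.mul_div_cancel_right (h.pos' _) (h.ne_top' _), mul_comm (m (x - 1)),
      mul_div_assoc]
  have key : ∀ n : ℕ, ∑ k ∈ Finset.range n, m (y + 1 - k) * upProd p (y + 1 - k) k +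
      (∏ i ∈ Finset.range n, p (y - i)) * (m (y - n) / q (y + 1 - n)) = m y / q (y + 1) := by
    intro n
    induction n with
    | zero => simp
    | succ n ih =>
      rw [← ih, Finset.sum_range_succ, Finset.prod_range_succ, add_assoc, upProd_sub]
      congr 1
      have := hbal' (y - n)
      rw [show y - (n : ℤ) + 1 = y + 1 - n by ring] at this
      rw [this, show y - ((n + 1 : ℕ) : ℤ) = y - n - 1 by push_cast; ring,
        show y + 1 - ((n + 1 : ℕ) : ℤ) = y - n by push_cast; ring]
      ring
  rw [← Finset.sum_mul]
  calc _ ≤ m y / q (y + 1) * q (y + 1) := by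
        gcongr
        rw [← key n]
        exact le_self_add
    _ = m y := ENNReal.div_mul_cancel (h.pos' _) (h.ne_top' _)

theorem tsum_statMeasure_stepOp_le (h : UpDown p q) (g : ℤ → ℝ≥0∞) :
    ∑' x, statMeasure p q x * stepOp p q g x ≤ ∑' x, statMeasure p q x * g x := by
  set m := statMeasure p q
  have h1 : ∀ k : ℕ, ∑' x, m x * (upProd p x k * q (x + k) * g (x - 1 + k)) =
      ∑' y, m (y + 1 - k) * upProd p (y + 1 - k) k * q (y + 1) * g y := by
    intro k
    rw [← (Equiv.addRight (1 - k : ℤ)).tsum_eq]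
    refine tsum_congr fun y => ?_
    simp only [Equiv.coe_addRight]
    rw [show y + (1 - (k : ℤ)) + k = y + 1 by ring, show y + (1 - (k : ℤ)) - 1 + k = y by ring,
      show y + (1 - (k : ℤ)) = y + 1 - k by ring]
    ring
  calc ∑' x, m x * stepOp p q g x
      = ∑' x, ∑' k : ℕ, m x * (upProd p x k * q (x + k) * g (x - 1 + k)) := by
        simp only [stepOp, ENNReal.tsum_mul_left]
    _ = ∑' k : ℕ, ∑' y, m (y + 1 - k) * upProd p (y + 1 - k) k * q (y + 1) * g y := by
        rw [ENNReal.tsum_comm]; exact tsum_congr h1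
    _ = ∑' y, (∑' k : ℕ, m (y + 1 - k) * upProd p (y + 1 - k) k * q (y + 1)) * g y := by
        rw [ENNReal.tsum_comm]; simp only [ENNReal.tsum_mul_right]
    _ ≤ _ := by
        refine ENNReal.tsum_le_tsum fun y => ?_
        gcongr
        exact ENNReal.tsum_le_of_sum_range_le fun n => sum_statMeasure_upProd_le h y n

theorem tsum_statMeasure_iterate_le (h : UpDown p q) (g : ℤ → ℝ≥0∞) (r : ℕ) :
    ∑' x, statMeasure p q x * (stepOp p q)^[r] g x ≤ ∑' x, statMeasure p q x * g x := by
  induction r with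
  | zero => rfl
  | succ r ih =>
    rw [Function.iterate_succ_apply']
    exact (tsum_statMeasure_stepOp_le h _).trans ih

theorem tsum_statWeight_ne_top (h : UpDown p q) :
    ∑' n : ℕ, statWeight p q n * ((n + 1 : ℕ) : ℝ≥0∞) ≠ ⊤ := by
  obtain ⟨κ, hκ, N, hN⟩ := h.drift
  have hκt : κ ≠ ⊤ := ne_top_of_lt hκ
  have hκr : κ.toReal < 1 / 2 := by
    simpa using (ENNReal.toReal_lt_toReal hκt (by simp)).2 hκ
  set a : ℕ → ℝ := fun n => (statWeight p q n * ((n + 1 : ℕ) : ℝ≥0∞)).toReal with ha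
  have hat : ∀ n : ℕ, statWeight p q n * ((n + 1 : ℕ) : ℝ≥0∞) ≠ ⊤ := fun n =>
    ENNReal.mul_ne_top (statWeight_ne_top h n) (ENNReal.natCast_ne_top _)
  have ha0 : ∀ n, 0 ≤ a n := fun n => ENNReal.toReal_nonneg
  have hκ0 : 0 ≤ κ.toReal := ENNReal.toReal_nonneg
  set θ : ℝ := κ.toReal / (1 - κ.toReal) with hθ
  have hθ0 : 0 ≤ θ := div_nonneg hκ0 (by linarith)
  have hθ1 : θ < 1 := by rw [hθ, div_lt_one (by linarith)]; linarith
  have hsum : Summable a := by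
    refine summable_of_ratio_norm_eventually_le (r := (1 + θ) / 2) (by linarith) ?_
    have h2 : ∀ᶠ n : ℕ in atTop, (2 : ℝ) / (1 - θ) ≤ n :=
      tendsto_natCast_atTop_atTop.eventually_ge_atTop _
    filter_upwards [h2, eventually_ge_atTop N] with n hn hnN
    rw [Real.norm_of_nonneg (ha0 _), Real.norm_of_nonneg (ha0 _)]
    have hp1 : (p (n + 1)).toReal ≤ κ.toReal := by
      have := ENNReal.toReal_mono hκt (hN (n + 1) (by omega))
      simpa using this
    have hq1 : 1 - κ.toReal ≤ (q (n + 1)).toReal := by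
      have := congrArg ENNReal.toReal (h.add_eq_one (n + 1))
      rw [ENNReal.toReal_add (h.ne_top _) (h.ne_top' _), ENNReal.toReal_one] at this
      linarith
    have hbal := congrArg ENNReal.toReal (statWeight_succ h n)
    simp only [ENNReal.toReal_mul] at hbal
    have hW0 : 0 ≤ (statWeight p q n).toReal := ENNReal.toReal_nonneg
    have hW1 : 0 ≤ (statWeight p q (n + 1)).toReal := ENNReal.toReal_nonneg
    have hW : (statWeight p q (n + 1)).toReal ≤ θ * (statWeight p q n).toReal := by
      rw [hθ, div_mul_eq_mul_div, le_div_iff₀ (by linarith)]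
      calc _ ≤ (statWeight p q (n + 1)).toReal * (q (n + 1)).toReal := by gcongr
        _ = _ := hbal
        _ ≤ (statWeight p q n).toReal * κ.toReal := by gcongr
        _ = _ := mul_comm _ _
    have hnθ : θ * ((n : ℝ) + 2) ≤ (1 + θ) / 2 * (n + 1) := by
      rw [div_le_iff₀ (by linarith)] at hn
      nlinarith
    simp only [ha, ENNReal.toReal_mul, ENNReal.toReal_natCast]
    push_cast
    calc (statWeight p q (n + 1)).toReal * ((n : ℝ) + 1 + 1)
        ≤ θ * (statWeight p q n).toReal * ((n : ℝ) + 1 + 1) := by gcongr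
      _ = (statWeight p q n).toReal * (θ * (n + 2)) := by ring
      _ ≤ (statWeight p q n).toReal * ((1 + θ) / 2 * (n + 1)) := by gcongr
      _ = _ := by ring
  have := hsum.tsum_ofReal_ne_top
  simpa only [ha, ENNReal.ofReal_toReal (hat _)] using this

theorem tendsto_tsum_statWeight (h : UpDown p q) {F : ℕ → ℕ → ℝ≥0∞}
    (hF : ∀ r n, F r n ≤ (n + 1 : ℕ)) (hlim : ∀ n, Tendsto (F · n) atTop (nhds 0)) :
    Tendsto (fun r => ∑' n : ℕ, statWeight p q n * F r n) atTop (nhds 0) := by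
  have := tendsto_lintegral_of_dominated_convergence (μ := Measure.count (α := ℕ))
    (F := fun r n => statWeight p q n * F r n) (f := fun _ => 0)
    (fun n : ℕ => statWeight p q n * ((n + 1 : ℕ) : ℝ≥0∞)) (fun r => .of_discrete)
    (fun r => .of_forall fun n => mul_le_mul_right (hF r n) _)
    (by rw [lintegral_count]; exact tsum_statWeight_ne_top h)
    (.of_forall fun n => by
      simpa using ENNReal.Tendsto.const_mul (hlim n) (Or.inr (statWeight_ne_top h n)))
  simpa [lintegral_count] using this

end Stationary

section Drift

variable {p q : ℤ → ℝ≥0∞}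

/-- The error terms in the comparison of the `r`-step mean with the stationary mean. -/
def driftError (p q : ℤ → ℝ≥0∞) (B r : ℕ) : ℝ≥0∞ :=
  ∑' n : ℕ, statWeight p q n * ((n + 1 - B : ℕ) : ℝ≥0∞) +
    ∑' n : ℕ, statWeight p q n * ∑ j ∈ Finset.range (n + 1), (diffOp p q)^[r] 1 (-j)

theorem sum_iterate_diffOp_le (h : UpDown p q) (r n : ℕ) :
    ∑ j ∈ Finset.range (n + 1), (diffOp p q)^[r] 1 (-j : ℤ) ≤ ((n + 1 : ℕ) : ℝ≥0∞) := by
  calc _ ≤ ∑ j ∈ Finset.range (n + 1), (1 : ℝ≥0∞) :=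
        Finset.sum_le_sum fun j _ => iterate_diffOp_le_one h r _
    _ = _ := by simp

theorem driftError_le (h : UpDown p q) (B r : ℕ) :
    driftError p q B r ≤ 2 * ∑' n : ℕ, statWeight p q n * ((n + 1 : ℕ) : ℝ≥0∞) := by
  rw [two_mul]
  refine add_le_add (ENNReal.tsum_le_tsum fun n => ?_) (ENNReal.tsum_le_tsum fun n => ?_)
  · gcongr
    omega
  · exact mul_le_mul_right (sum_iterate_diffOp_le h r n) _

theorem exists_driftError_le (h : UpDown p q) {ε : ℝ≥0∞} (hε : ε ≠ 0) :
    ∃ B, 1 ≤ B ∧ ∃ R, B ≤ R ∧ ∀ r, R ≤ r → driftError p q B r ≤ ε := by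
  have h1 : Tendsto (fun B => ∑' n : ℕ, statWeight p q n * ((n + 1 - B : ℕ) : ℝ≥0∞)) atTop
      (nhds 0) := by
    refine tendsto_tsum_statWeight h (fun B n => by gcongr; omega) fun n => ?_
    refine tendsto_const_nhds.congr' ?_
    filter_upwards [eventually_ge_atTop (n + 1)] with B hB
    simp [Nat.sub_eq_zero_of_le hB]
  have h2 : Tendsto (fun r => ∑' n : ℕ, statWeight p q n *
      ∑ j ∈ Finset.range (n + 1), (diffOp p q)^[r] 1 (-j : ℤ)) atTop (nhds 0) := by
    refine tendsto_tsum_statWeight h (sum_iterate_diffOp_le h) fun n => ?_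
    simpa using tendsto_finsetSum (Finset.range (n + 1)) fun (j : ℕ) _ =>
      tendsto_iterate_diffOp h (-j)
  have hε2 : ε / 2 ≠ 0 := by simp [hε]
  obtain ⟨B, hB, hB1⟩ := ((h1.eventually_le_const (pos_iff_ne_zero.2 hε2)).and
    (eventually_ge_atTop 1)).exists
  obtain ⟨R, hR⟩ := eventually_atTop.1 (h2.eventually_le_const (pos_iff_ne_zero.2 hε2))
  refine ⟨B, hB1, max B R, le_max_left _ _, fun r hr => ?_⟩
  rw [← ENNReal.add_halves ε]
  exact add_le_add hB (hR r (le_of_max_le_right hr))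

theorem two_mul_iterate_stepOp_add_one_le (h : UpDown p q) {B : ℕ} (hB : 1 ≤ B) (r : ℕ) :
    2 * (stepOp p q)^[r] (fun y => ((y + B).toNat : ℝ≥0∞)) 0 + 1 ≤
      2 * B + driftError p q B r := by
  set φ : ℤ → ℝ≥0∞ := fun y => ((y + B).toNat : ℝ≥0∞) with hφ
  set Z := ∑' n : ℕ, statWeight p q n with hZ
  have hZ1 : Z ≠ 0 := by
    intro h0
    have := ENNReal.tsum_eq_zero.1 h0 0
    simp [statWeight] at this
  have hZ1' : 1 ≤ Z := by
    refine le_trans ?_ (ENNReal.le_tsum 0)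
    simp [statWeight]
  have hZt : Z ≠ ⊤ := by
    refine ne_top_of_le_ne_top (tsum_statWeight_ne_top h) (ENNReal.tsum_le_tsum fun n => ?_)
    exact le_mul_of_one_le_right zero_le (by exact_mod_cast Nat.le_add_left 1 n)
  have hmono : Monotone φ := fun x y hxy => by
    simp only [hφ]
    exact_mod_cast Int.toNat_le_toNat (add_le_add_left hxy _)
  have hlip : ∀ x, φ x ≤ φ (x - 1) + 1 := fun x => by
    simp only [hφ]
    exact_mod_cast (show (x + B).toNat ≤ (x - 1 + B).toNat + 1 by omega)
  set G := (stepOp p q)^[r] φ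
  have h1 : Z * (2 * G 0) ≤ Z * ((2 * B - 1 : ℕ) + driftError p q B r) := by
    calc Z * (2 * G 0) = ∑' n : ℕ, statWeight p q n * (2 * G 0) := by
          rw [hZ, ENNReal.tsum_mul_right]
      _ ≤ ∑' n : ℕ, statWeight p q n * (G n + (G (Int.negSucc n) +
          ∑ j ∈ Finset.range (n + 1), (diffOp p q)^[r] 1 (-j))) := by
          refine ENNReal.tsum_le_tsum fun n => ?_
          rw [two_mul]
          gcongr
          · exact monotone_iterate_stepOp h hmono r (by omega)
          · exact iterate_stepOp_zero_le h hlip r n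
      _ = ∑' x, statMeasure p q x * G x + ∑' n : ℕ, statWeight p q n *
          ∑ j ∈ Finset.range (n + 1), (diffOp p q)^[r] 1 (-j) := by
          rw [tsum_statMeasure, ← ENNReal.tsum_add]
          refine tsum_congr fun n => ?_
          ring
      _ ≤ ∑' x, statMeasure p q x * φ x + ∑' n : ℕ, statWeight p q n *
          ∑ j ∈ Finset.range (n + 1), (diffOp p q)^[r] 1 (-j) := by
          exact add_le_add_left (tsum_statMeasure_iterate_le h φ r) _
      _ ≤ (Z * (2 * B - 1 : ℕ) + ∑' n : ℕ, statWeight p q n * ((n + 1 - B : ℕ) : ℝ≥0∞)) +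
          ∑' n : ℕ, statWeight p q n *
          ∑ j ∈ Finset.range (n + 1), (diffOp p q)^[r] 1 (-j) := by
          gcongr
          rw [tsum_statMeasure, hZ, ← ENNReal.tsum_mul_right, ← ENNReal.tsum_add]
          refine ENNReal.tsum_le_tsum fun n => ?_
          rw [← mul_add]
          refine mul_le_mul_right ?_ _
          simp only [hφ]
          exact_mod_cast (show ((n : ℤ) + B).toNat + (Int.negSucc n + B).toNat ≤
            2 * B - 1 + (n + 1 - B) by omega)
      _ = Z * (2 * B - 1 : ℕ) + driftError p q B r := by rw [driftError, add_assoc]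
      _ ≤ Z * (2 * B - 1 : ℕ) + Z * driftError p q B r := by
          gcongr
          exact le_mul_of_one_le_left zero_le hZ1'
      _ = _ := by ring
  have h2 := (ENNReal.mul_le_mul_iff_right hZ1 hZt).1 h1
  calc 2 * G 0 + 1 ≤ (2 * B - 1 : ℕ) + driftError p q B r + 1 := by gcongr
    _ = ((2 * B - 1 + 1 : ℕ) : ℝ≥0∞) + driftError p q B r := by push_cast; ring
    _ = _ := by rw [Nat.sub_add_cancel (by omega)]; push_cast; rfl

end Drift

section Kernel

variable {w : ℤ → ℝ}

theorem GoodWeight.pfun_pos (hw : GoodWeight w) (x : ℤ) : 0 < pfun w x :=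
  div_pos (hw.1 _) (add_pos (hw.1 _) (hw.1 _))

theorem GoodWeight.qfun_pos (hw : GoodWeight w) (x : ℤ) : 0 < qfun w x :=
  div_pos (hw.1 _) (add_pos (hw.1 _) (hw.1 _))

theorem GoodWeight.upDown (hw : GoodWeight w) :
    UpDown (fun x => ENNReal.ofReal (pfun w x)) (fun x => ENNReal.ofReal (qfun w x)) := by
  have hpos := fun x => add_pos (hw.1 x) (hw.1 (-x))
  have hmono : Monotone w := monotone_int_of_le_succ hw.2.1
  have hanti : Antitone fun x => ENNReal.ofReal (pfun w x) := by
    intro x y hxy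
    refine ENNReal.ofReal_le_ofReal ?_
    rw [pfun, pfun, div_le_div_iff₀ (hpos _) (hpos _)]
    have := mul_le_mul (hmono (neg_le_neg hxy)) (hmono hxy) (hw.1 _).le (hw.1 _).le
    linarith
  refine ⟨fun x => ?_, fun x => ?_, hanti, fun x => ?_, ?_⟩
  · rw [← ENNReal.ofReal_add (hw.pfun_pos x).le (hw.qfun_pos x).le, pfun, qfun, ← add_div,
      add_comm (w (-x)), div_self (hpos x).ne', ENNReal.ofReal_one]
  · simp only [pfun, qfun, neg_neg, add_comm]
  · simpa using hw.pfun_pos x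
  · obtain ⟨c, hc, hev⟩ := hw.2.2
    obtain ⟨M, hM⟩ := eventually_atTop.1 hev
    refine ⟨ENNReal.ofReal (pfun w M.toNat), ?_, M.toNat, fun n hn => hanti (by exact_mod_cast hn)⟩
    have h1 := hM M.toNat (by omega)
    rw [show (1 / 2 : ℝ≥0∞) = ENNReal.ofReal (1 / 2) by
      rw [ENNReal.ofReal_div_of_pos two_pos]; simp]
    rw [ENNReal.ofReal_lt_ofReal_iff (by norm_num), pfun, div_lt_div_iff₀ (hpos _) two_pos]
    linarith

theorem GoodWeight.Pker_nonneg (hw : GoodWeight w) (x y : ℤ) : 0 ≤ Pker w x y := by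
  unfold Pker
  split_ifs
  · exact mul_nonneg (Finset.prod_nonneg fun z _ => (hw.pfun_pos z).le) (hw.qfun_pos _).le
  · exact le_rfl

theorem GoodWeight.Pm_nonneg (hw : GoodWeight w) (m : ℕ) (x y : ℤ) : 0 ≤ Pm w m x y := by
  induction m generalizing y with
  | zero => unfold Pm; split_ifs <;> simp
  | succ m ih => exact tsum_nonneg fun z => mul_nonneg (ih z) (hw.Pker_nonneg _ _)

theorem GoodWeight.Qker_nonneg (hw : GoodWeight w) (r s : ℤ) : 0 ≤ Qker w r s := by
  unfold Qker
  split_ifs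
  · exact hw.Pm_nonneg _ _ _
  · exact zero_le_one
  · exact le_rfl

theorem prod_Icc_eq (f : ℤ → ℝ) (x : ℤ) (k : ℕ) :
    ∏ z ∈ Finset.Icc x (x - 1 + k), f z = ∏ i ∈ Finset.range k, f (x + i) := by
  induction k with
  | zero => rw [Finset.Icc_eq_empty (by simp)]; simp
  | succ k ih =>
    rw [Finset.prod_range_succ, ← ih, mul_comm, ← Finset.prod_insert (by simp)]
    congr 1
    ext z
    simp only [Finset.mem_Icc, Finset.mem_insert]
    omega

theorem GoodWeight.tsum_Pker (hw : GoodWeight w) (g : ℤ → ℝ≥0∞) (x : ℤ) :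
    ∑' y, ENNReal.ofReal (Pker w x y) * g y =
      stepOp (fun x => ENNReal.ofReal (pfun w x)) (fun x => ENNReal.ofReal (qfun w x)) g x := by
  have hinj : Function.Injective fun k : ℕ => x - 1 + (k : ℤ) := fun a b hab => by
    simpa using hab
  rw [← hinj.tsum_eq]
  · refine tsum_congr fun k => ?_
    rw [Pker, if_pos (by omega), prod_Icc_eq, show x - 1 + (k : ℤ) + 1 = x + k by ring,
      ENNReal.ofReal_mul (Finset.prod_nonneg fun z _ => (hw.pfun_pos _).le),
      ENNReal.ofReal_prod_of_nonneg fun z _ => (hw.pfun_pos _).le, upProd]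
  · intro y hy
    by_contra hcon
    apply hy
    have : ¬ x - 1 ≤ y := fun hle => hcon ⟨(y - (x - 1)).toNat, by dsimp only; omega⟩
    simp [Pker, this]

theorem ofReal_tsum_le {f : ℤ → ℝ} (hf : ∀ z, 0 ≤ f z) :
    ENNReal.ofReal (∑' z, f z) ≤ ∑' z, ENNReal.ofReal (f z) := by
  by_cases hs : Summable f
  · exact (ENNReal.ofReal_tsum_of_nonneg hf hs).le
  · simp [tsum_eq_zero_of_not_summable hs]

theorem GoodWeight.tsum_Pm_le (hw : GoodWeight w) (g : ℤ → ℝ≥0∞) (m : ℕ) (x : ℤ) :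
    ∑' y, ENNReal.ofReal (Pm w m x y) * g y ≤
      (stepOp (fun x => ENNReal.ofReal (pfun w x))
        (fun x => ENNReal.ofReal (qfun w x)))^[m] g x := by
  induction m generalizing g with
  | zero =>
    rw [tsum_eq_single x fun y hy => by simp [Pm, hy.symm]]
    simp [Pm]
  | succ m ih =>
    calc ∑' y, ENNReal.ofReal (Pm w (m + 1) x y) * g y
        ≤ ∑' y, (∑' z, ENNReal.ofReal (Pm w m x z) * ENNReal.ofReal (Pker w z y)) * g y := by
          refine ENNReal.tsum_le_tsum fun y => mul_le_mul_left ?_ _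
          refine (ofReal_tsum_le fun z =>
            mul_nonneg (hw.Pm_nonneg _ _ _) (hw.Pker_nonneg _ _)).trans_eq ?_
          exact tsum_congr fun z => ENNReal.ofReal_mul (hw.Pm_nonneg _ _ _)
      _ = ∑' z, ENNReal.ofReal (Pm w m x z) * ∑' y, ENNReal.ofReal (Pker w z y) * g y := by
          simp only [← ENNReal.tsum_mul_right, ← ENNReal.tsum_mul_left, mul_assoc]
          exact ENNReal.tsum_comm
      _ ≤ _ := by
          simp only [hw.tsum_Pker]
          exact ih _

theorem Pm_eq_zero (m : ℕ) {x y : ℤ} (hy : y < x - m) : Pm w m x y = 0 := by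
  induction m generalizing y with
  | zero => rw [Pm, if_neg (by rintro rfl; simp at hy)]
  | succ m ih =>
    rw [Pm]
    convert tsum_zero with z
    by_cases hz : z < x - m
    · rw [ih hz, zero_mul]
    · rw [Pker, if_neg (by push_cast at hy; omega), mul_zero]

theorem GoodWeight.Pm_sub_pos (hw : GoodWeight w) (m : ℕ) (x : ℤ) : 0 < Pm w m x (x - m) := by
  induction m with
  | zero => simp [Pm]
  | succ m ih =>
    rw [Pm, tsum_eq_single (x - m)]
    · refine mul_pos ih ?_
      rw [Pker, if_pos (by push_cast; omega)]
      exact mul_pos (Finset.prod_pos fun z _ => hw.pfun_pos z) (hw.qfun_pos _)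
    · intro z hz
      rcases lt_or_gt_of_ne hz with hlt | hgt
      · rw [Pm_eq_zero m hlt, zero_mul]
      · rw [Pker, if_neg (by push_cast; omega), mul_zero]

theorem tsum_Qker (r : ℕ) (f : ℤ → ℝ≥0∞) :
    ∑' s, ENNReal.ofReal (Qker w r s) * f s =
      ∑' y, ENNReal.ofReal (Pm w r 0 y) * f (y + r) := by
  rw [← (Equiv.addRight (r : ℤ)).tsum_eq]
  refine tsum_congr fun y => ?_
  simp [Qker]

theorem GoodWeight.tsum_Qker_le_one (hw : GoodWeight w) (r : ℕ) :
    ∑' s, ENNReal.ofReal (Qker w r s) ≤ 1 := by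
  have h1 := tsum_Qker (w := w) r fun _ => 1
  simp only [mul_one] at h1
  rw [h1]
  have h2 := hw.tsum_Pm_le (fun _ => 1) r 0
  simp only [mul_one] at h2
  refine h2.trans_eq ?_
  rw [Function.iterate_fixed (stepOp_const hw.upDown 1)]

theorem GoodWeight.Qker_zero_pos (hw : GoodWeight w) (r : ℕ) : 0 < Qker w r 0 := by
  have := hw.Pm_sub_pos r 0
  simpa [Qker] using this

theorem GoodWeight.two_mul_tsum_Qker_add_one_le (hw : GoodWeight w) {B r : ℕ} (hB : 1 ≤ B)
    (hr : B ≤ r) :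
    2 * ∑' s, ENNReal.ofReal (Qker w r s) * (s.toNat : ℝ≥0∞) + 1 ≤
      2 * r + driftError (fun x => ENNReal.ofReal (pfun w x))
        (fun x => ENNReal.ofReal (qfun w x)) B r := by
  set E := driftError (fun x => ENNReal.ofReal (pfun w x))
    (fun x => ENNReal.ofReal (qfun w x)) B r
  have h1 : ∑' s, ENNReal.ofReal (Qker w r s) * (s.toNat : ℝ≥0∞) ≤
      (stepOp (fun x => ENNReal.ofReal (pfun w x)) (fun x => ENNReal.ofReal (qfun w x)))^[r]
        (fun y => ((y + B).toNat : ℝ≥0∞)) 0 + (r - B : ℕ) := by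
    have h2 := hw.tsum_Qker_le_one r
    have h3 := tsum_Qker (w := w) r fun _ => 1
    simp only [mul_one] at h3
    rw [h3] at h2
    rw [tsum_Qker]
    calc ∑' y, ENNReal.ofReal (Pm w r 0 y) * ((y + r).toNat : ℝ≥0∞)
        ≤ ∑' y, (ENNReal.ofReal (Pm w r 0 y) * ((y + B).toNat : ℝ≥0∞) +
          ENNReal.ofReal (Pm w r 0 y) * (r - B : ℕ)) := by
          refine ENNReal.tsum_le_tsum fun y => ?_
          rw [← mul_add]
          gcongr
          exact_mod_cast (show (y + r).toNat ≤ (y + B).toNat + (r - B) by omega)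
      _ = ∑' y, ENNReal.ofReal (Pm w r 0 y) * ((y + B).toNat : ℝ≥0∞) +
          (∑' y, ENNReal.ofReal (Pm w r 0 y)) * (r - B : ℕ) := by
          rw [ENNReal.tsum_add, ENNReal.tsum_mul_right]
      _ ≤ _ + 1 * (r - B : ℕ) :=
          add_le_add (hw.tsum_Pm_le _ r 0) (mul_le_mul_left h2 _)
      _ = _ := by rw [one_mul]
  have h2 := two_mul_iterate_stepOp_add_one_le hw.upDown hB r
  set M := (stepOp (fun x => ENNReal.ofReal (pfun w x))
    (fun x => ENNReal.ofReal (qfun w x)))^[r] (fun y => ((y + B).toNat : ℝ≥0∞)) 0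
  calc _ ≤ 2 * (M + ((r - B : ℕ) : ℝ≥0∞)) + 1 := by gcongr
    _ = 2 * M + 1 + 2 * ((r - B : ℕ) : ℝ≥0∞) := by ring
    _ ≤ 2 * B + E + 2 * ((r - B : ℕ) : ℝ≥0∞) := by gcongr
    _ = 2 * ((B + (r - B) : ℕ) : ℝ≥0∞) + E := by push_cast; ring
    _ = _ := by rw [Nat.add_sub_cancel' hr]

/-- The Lyapunov function: linear growth plus a jump at the origin. -/
def lyapunov (a G : ℝ≥0∞) (s : ℤ) : ℝ≥0∞ := a * s.toNat + if 0 < s then G else 0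

theorem GoodWeight.exists_lyapunov (hw : GoodWeight w) {δ : ℝ} (hδ : 0 < δ) :
    ∃ G : ℝ≥0∞, G ≠ ⊤ ∧ ∀ r : ℕ, 1 ≤ r →
      ∑' s, ENNReal.ofReal (Qker w r s) * lyapunov (ENNReal.ofReal (2 + δ)) G s + 1 ≤
        lyapunov (ENNReal.ofReal (2 + δ)) G r := by
  set P : ℤ → ℝ≥0∞ := fun x => ENNReal.ofReal (pfun w x)
  set Q : ℤ → ℝ≥0∞ := fun x => ENNReal.ofReal (qfun w x)
  have h : UpDown P Q := hw.upDown
  set e : ℝ≥0∞ := ENNReal.ofReal (δ / 2) with he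
  have he0 : e ≠ 0 := by simpa [he] using hδ
  have het : e ≠ ⊤ := ENNReal.ofReal_ne_top
  have ha : ENNReal.ofReal (2 + δ) = (1 + e) * 2 := by
    rw [he, ← ENNReal.ofReal_one, ← ENNReal.ofReal_add zero_le_one (by positivity),
      ← ENNReal.ofReal_ofNat 2, ← ENNReal.ofReal_mul (by positivity)]
    congr 1
    ring
  set M : ℕ → ℝ≥0∞ := fun r => ∑' s, ENNReal.ofReal (Qker w r s) * (s.toNat : ℝ≥0∞) with hM
  set S : ℕ → ℝ≥0∞ := fun r => ∑' s, ENNReal.ofReal (Qker w r s) * (if 0 < s then 1 else 0) with hS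
  set Q0 : ℕ → ℝ≥0∞ := fun r => ENNReal.ofReal (Qker w r 0) with hQ0
  have hS1 : ∀ r, S r + Q0 r ≤ 1 := by
    intro r
    refine le_trans ?_ (hw.tsum_Qker_le_one r)
    have : Q0 r = ∑' s, ENNReal.ofReal (Qker w r s) * (if s = 0 then 1 else 0) := by
      rw [tsum_eq_single 0 fun s hs => by simp [hs]]
      simp [hQ0]
    rw [this, hS, ← ENNReal.tsum_add]
    refine ENNReal.tsum_le_tsum fun s => ?_
    rw [← mul_add]
    refine mul_le_of_le_one_right zero_le ?_
    split_ifs with h1 h2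
    · omega
    all_goals simp
  have hQ0p : ∀ r, Q0 r ≠ 0 := fun r => by simpa [hQ0] using hw.Qker_zero_pos r
  obtain ⟨B, hB, R, hBR, hR⟩ := exists_driftError_le h
    (ε := e / (1 + e)) (ENNReal.div_ne_zero.2 ⟨he0, by simp [het]⟩)
  set C : ℝ≥0∞ := (1 + e) * (2 * ∑' n : ℕ, statWeight P Q n * ((n + 1 : ℕ) : ℝ≥0∞)) with hC
  have hCt : C ≠ ⊤ := ENNReal.mul_ne_top (by simp [het])
    (ENNReal.mul_ne_top (by simp) (tsum_statWeight_ne_top h))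
  set G : ℝ≥0∞ := ∑ r ∈ Finset.range R, C / Q0 r with hG
  refine ⟨G, ?_, fun r hr => ?_⟩
  · exact (ENNReal.sum_lt_top.2 fun r _ => (ENNReal.div_ne_top hCt (hQ0p r)).lt_top).ne
  have hsum : ∑' s, ENNReal.ofReal (Qker w r s) * lyapunov (ENNReal.ofReal (2 + δ)) G s =
      (1 + e) * (2 * M r) + G * S r := by
    rw [← mul_assoc, ← ha, hM, hS, ← ENNReal.tsum_mul_left, ← ENNReal.tsum_mul_left,
      ← ENNReal.tsum_add]
    refine tsum_congr fun s => ?_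
    rw [lyapunov]
    split_ifs <;> ring
  have hV : lyapunov (ENNReal.ofReal (2 + δ)) G r = (1 + e) * (2 * r) + G := by
    rw [lyapunov, if_pos (by exact_mod_cast hr), ha, mul_assoc]
    simp
  rw [hsum, hV]
  have hGS : G * S r ≤ G := mul_le_of_le_one_right zero_le (le_self_add.trans (hS1 r))
  rcases lt_or_ge r R with hlt | hge
  · have h1 := hw.two_mul_tsum_Qker_add_one_le le_rfl hr
    have h2 : C ≤ G * Q0 r := by
      calc C = C / Q0 r * Q0 r :=
            (ENNReal.div_mul_cancel (hQ0p r) ENNReal.ofReal_ne_top).symm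
        _ ≤ _ := by
          gcongr
          exact Finset.single_le_sum (f := fun r => C / Q0 r) (fun _ _ => zero_le)
            (Finset.mem_range.2 hlt)
    calc (1 + e) * (2 * M r) + G * S r + 1 ≤ (1 + e) * (2 * M r) + G * S r + (1 + e) := by
          gcongr; exact le_self_add
      _ = (1 + e) * (2 * M r + 1) + G * S r := by ring
      _ ≤ (1 + e) * (2 * r + driftError P Q 1 r) + G * S r := by gcongr
      _ ≤ (1 + e) * (2 * r + 2 * ∑' n : ℕ, statWeight P Q n * ((n + 1 : ℕ) : ℝ≥0∞)) +
          G * S r := by gcongr; exact driftError_le h 1 r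
      _ = (1 + e) * (2 * r) + (C + G * S r) := by rw [hC]; ring
      _ ≤ (1 + e) * (2 * r) + (G * Q0 r + G * S r) := by gcongr
      _ = (1 + e) * (2 * r) + G * (S r + Q0 r) := by ring
      _ ≤ _ := by gcongr; exact mul_le_of_le_one_right zero_le (hS1 r)
  · have h1 := hw.two_mul_tsum_Qker_add_one_le hB (hBR.trans hge)
    refine (ENNReal.add_le_add_iff_right het).1 ?_
    calc (1 + e) * (2 * M r) + G * S r + 1 + e = (1 + e) * (2 * M r + 1) + G * S r := by ring
      _ ≤ (1 + e) * (2 * r + driftError P Q B r) + G := by gcongr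
      _ ≤ (1 + e) * (2 * r + e / (1 + e)) + G := by gcongr; exact hR r hge
      _ = (1 + e) * (2 * r) + G + e := by
        rw [mul_add, ENNReal.mul_div_cancel (by simp) (by simp [het])]
        ring

end Kernel

section Hitting

variable {Ω : Type*} [MeasurableSpace Ω] {μ : Measure Ω} {K : ℤ → ℤ → ℝ} {L : ℕ → Ω → ℤ} {a : ℤ}

theorem KChain.measure_cylinder_succ (hL : KChain μ K L a) (hK : ∀ x y, 0 ≤ K x y) (n : ℕ)
    (x : ℕ → ℤ) (y : ℤ) :
    μ {ω | (∀ i ≤ n, L i ω = x i) ∧ L (n + 1) ω = y} =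
      μ {ω | ∀ i ≤ n, L i ω = x i} * ENNReal.ofReal (K (x n) y) := by
  set x' : ℕ → ℤ := Function.update x (n + 1) y with hx'
  have hne : ∀ i ≤ n, x' i = x i := fun i hi => Function.update_of_ne (by omega) _ _
  have h1 : {ω | (∀ i ≤ n, L i ω = x i) ∧ L (n + 1) ω = y} =
      {ω | ∀ i ≤ n + 1, L i ω = x' i} := by
    ext ω
    constructor
    · rintro ⟨h1, h2⟩ i hi
      rcases Nat.lt_or_eq_of_le hi with hlt | rfl
      · rw [hne i (by omega)]; exact h1 i (by omega)
      · simpa [hx'] using h2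
    · intro h
      refine ⟨fun i hi => ?_, ?_⟩
      · rw [← hne i hi]; exact h i (by omega)
      · simpa [hx'] using h (n + 1) le_rfl
  have h2 : ∏ i ∈ Finset.range n, K (x' i) (x' (i + 1)) =
      ∏ i ∈ Finset.range n, K (x i) (x (i + 1)) := by
    refine Finset.prod_congr rfl fun i hi => ?_
    rw [Finset.mem_range] at hi
    rw [hne i (by omega), hne (i + 1) (by omega)]
  rw [h1, hL.2, hL.2, Finset.prod_range_succ, h2, hne 0 (Nat.zero_le _), hne n le_rfl,
    ← mul_assoc, ENNReal.ofReal_mul]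
  · simp [hx']
  · exact mul_nonneg (by split_ifs <;> simp) (Finset.prod_nonneg fun i _ => hK _ _)

/-- The event that the chain stays positive up to time `n`. -/
def stayPos (L : ℕ → Ω → ℤ) (n : ℕ) : Set Ω := {ω | ∀ i ≤ n, 0 < L i ω}

theorem measure_eq_tsum_inter {ι : Type*} [Countable ι] {Y : Ω → ι}
    (hY : ∀ i, MeasurableSet (Y ⁻¹' {i})) (E : Set Ω) :
    μ E = ∑' i, μ (E ∩ Y ⁻¹' {i}) := by
  have h1 : (⋃ i, Y ⁻¹' {i}) = Set.univ := by ext; simp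
  have h2 := measure_iUnion (μ := μ.restrict E) (f := fun i => Y ⁻¹' {i})
    (fun i j hij => Disjoint.preimage Y (by simpa using hij)) hY
  rw [h1, Measure.restrict_apply_univ] at h2
  rw [h2]
  exact tsum_congr fun i => by rw [Measure.restrict_apply (hY i), Set.inter_comm]

theorem KChain.measure_stayPos_inter (hL : KChain μ K L a) (hK : ∀ x y, 0 ≤ K x y) (n : ℕ)
    (x y : ℤ) :
    μ (stayPos L n ∩ {ω | L n ω = x} ∩ {ω | L (n + 1) ω = y}) =
      μ (stayPos L n ∩ {ω | L n ω = x}) * ENNReal.ofReal (K x y) := by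
  set Y : Ω → (Fin (n + 1) → ℤ) := fun ω i => L i ω
  have hY : Measurable Y := measurable_pi_lambda _ fun i => hL.1 i
  have hYs : ∀ b, MeasurableSet (Y ⁻¹' {b}) := fun b => hY (measurableSet_singleton b)
  rw [measure_eq_tsum_inter hYs (stayPos L n ∩ {ω | L n ω = x}),
    measure_eq_tsum_inter hYs, ← ENNReal.tsum_mul_right]
  refine tsum_congr fun b => ?_
  set b' : ℕ → ℤ := fun i => if h : i < n + 1 then b ⟨i, h⟩ else 0 with hb'
  have hcyl : Y ⁻¹' {b} = {ω | ∀ i ≤ n, L i ω = b' i} := by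
    ext ω
    simp only [Set.mem_preimage, Set.mem_singleton_iff, funext_iff, Set.mem_ofPred_eq, Y]
    constructor
    · intro h i hi
      rw [hb']
      simp only [dif_pos (Nat.lt_succ_of_le hi)]
      exact h ⟨i, _⟩
    · intro h i
      rw [h i (Nat.le_of_lt_succ i.2)]
      simp only [hb', dif_pos i.2]
  rw [hcyl]
  by_cases hb : (∀ i ≤ n, 0 < b' i) ∧ b' n = x
  · have h1 : stayPos L n ∩ {ω | L n ω = x} ∩ {ω | ∀ i ≤ n, L i ω = b' i} =
        {ω | ∀ i ≤ n, L i ω = b' i} := by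
      refine Set.inter_eq_right.2 fun ω hω => ⟨fun i hi => ?_, ?_⟩
      · rw [hω i hi]; exact hb.1 i hi
      · exact (hω n le_rfl).trans hb.2
    rw [h1, Set.inter_right_comm, h1, ← hb.2, ← hL.measure_cylinder_succ hK]
    rfl
  · have h1 : stayPos L n ∩ {ω | L n ω = x} ∩ {ω | ∀ i ≤ n, L i ω = b' i} = ∅ := by
      refine Set.eq_empty_of_forall_notMem fun ω hω => hb ⟨fun i hi => ?_, ?_⟩
      · rw [← hω.2 i hi]; exact hω.1.1 i hi
      · rw [← hω.2 n le_rfl]; exact hω.1.2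
    rw [Set.inter_right_comm, h1]
    simp

/-- The expectation of `V (L n)` on the event that the chain has stayed positive. -/
def aliveMean (μ : Measure Ω) (L : ℕ → Ω → ℤ) (V : ℤ → ℝ≥0∞) (n : ℕ) : ℝ≥0∞ :=
  ∑' x, μ (stayPos L n ∩ {ω | L n ω = x}) * V x

theorem KChain.aliveMean_succ_le (hL : KChain μ K L a) (hK : ∀ x y, 0 ≤ K x y) {V : ℤ → ℝ≥0∞}
    (hV : ∀ x, 0 < x → ∑' y, ENNReal.ofReal (K x y) * V y + 1 ≤ V x) (n : ℕ) :
    aliveMean μ L V (n + 1) + μ (stayPos L n) ≤ aliveMean μ L V n := by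
  have hsing : ∀ n x, MeasurableSet (L n ⁻¹' {x}) := fun n x =>
    hL.1 n (measurableSet_singleton x)
  have h1 : ∀ y, μ (stayPos L (n + 1) ∩ {ω | L (n + 1) ω = y}) ≤
      ∑' x, μ (stayPos L n ∩ {ω | L n ω = x}) * ENNReal.ofReal (K x y) := by
    intro y
    calc _ ≤ μ (stayPos L n ∩ {ω | L (n + 1) ω = y}) := by
          refine measure_mono (Set.inter_subset_inter_left _ fun ω hω i hi => hω i (by omega))
      _ = ∑' x, μ (stayPos L n ∩ {ω | L (n + 1) ω = y} ∩ L n ⁻¹' {x}) :=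
          measure_eq_tsum_inter (hsing n) _
      _ = _ := by
          refine tsum_congr fun x => ?_
          rw [← hL.measure_stayPos_inter hK, Set.inter_right_comm]
          rfl
  calc aliveMean μ L V (n + 1) + μ (stayPos L n)
      ≤ ∑' y, (∑' x, μ (stayPos L n ∩ {ω | L n ω = x}) * ENNReal.ofReal (K x y)) * V y +
        ∑' x, μ (stayPos L n ∩ {ω | L n ω = x}) := by
        refine add_le_add (ENNReal.tsum_le_tsum fun y => mul_le_mul_left (h1 y) _) ?_
        exact (measure_eq_tsum_inter (hsing n) _).le
    _ = ∑' x, μ (stayPos L n ∩ {ω | L n ω = x}) *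
        (∑' y, ENNReal.ofReal (K x y) * V y + 1) := by
        simp only [← ENNReal.tsum_mul_right]
        rw [ENNReal.tsum_comm, ← ENNReal.tsum_add]
        refine tsum_congr fun x => ?_
        rw [mul_add, mul_one, ← ENNReal.tsum_mul_left]
        simp only [mul_assoc]
    _ ≤ _ := by
        refine ENNReal.tsum_le_tsum fun x => ?_
        rcases lt_or_ge 0 x with hx | hx
        · exact mul_le_mul_right (hV x hx) _
        · have : stayPos L n ∩ {ω | L n ω = x} = ∅ := by
            refine Set.eq_empty_of_forall_notMem fun ω hω => ?_
            have h2 := hω.1 n le_rfl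
            have h3 : L n ω = x := hω.2
            omega
          simp [this]

theorem KChain.tsum_stayPos_le [IsProbabilityMeasure μ] (hL : KChain μ K L a)
    (hK : ∀ x y, 0 ≤ K x y) {V : ℤ → ℝ≥0∞}
    (hV : ∀ x, 0 < x → ∑' y, ENNReal.ofReal (K x y) * V y + 1 ≤ V x) :
    ∑' n, μ (stayPos L n) ≤ V a := by
  have h0 : aliveMean μ L V 0 ≤ V a := by
    rw [aliveMean, tsum_eq_single a]
    · exact mul_le_of_le_one_left zero_le prob_le_one
    · intro x hx
      have h1 := hL.2 0 fun _ => x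
      simp only [Nat.le_zero, forall_eq, if_neg hx, zero_mul, ENNReal.ofReal_zero] at h1
      rw [measure_mono_null Set.inter_subset_right h1, zero_mul]
  have h1 : ∀ n, aliveMean μ L V n + ∑ i ∈ Finset.range n, μ (stayPos L i) ≤ V a := by
    intro n
    induction n with
    | zero => simpa using h0
    | succ n ih =>
      rw [Finset.sum_range_succ, add_comm (∑ i ∈ Finset.range n, _), ← add_assoc]
      exact (add_le_add_left (hL.aliveMean_succ_le hK hV n) _).trans ih
  exact ENNReal.tsum_le_of_sum_range_le fun n => le_add_self.trans (h1 n)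

/-- The expected hitting time of the nonpositive integers is bounded by the sum of the survival
probabilities. -/
theorem tsum_hitting_le (hL : ∀ n, Measurable (L n)) :
    ∑' k : ℕ, (k : ℝ≥0∞) * μ {ω | L k ω ≤ 0 ∧ ∀ i < k, 0 < L i ω} ≤
      ∑' n, μ (stayPos L n) := by
  set H : ℕ → Set Ω := fun k => {ω | L k ω ≤ 0 ∧ ∀ i < k, 0 < L i ω} with hH
  have hHm : ∀ k, MeasurableSet (H k) := by
    intro k
    have : H k = L k ⁻¹' Set.Iic 0 ∩ ⋂ i, ⋂ (_ : i < k), L i ⁻¹' Set.Ioi 0 := by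
      ext; simp [hH]
    rw [this]
    exact (hL k measurableSet_Iic).inter
      (.iInter fun i => .iInter fun _ => hL i measurableSet_Ioi)
  have hdisj : Pairwise (Function.onFun Disjoint H) := by
    intro i j hij
    refine Set.disjoint_left.2 fun ω hi hj => ?_
    rcases lt_or_gt_of_ne hij with h | h
    · exact absurd hi.1 (not_le.2 (hj.2 i h))
    · exact absurd hj.1 (not_le.2 (hi.2 j h))
  calc ∑' k : ℕ, (k : ℝ≥0∞) * μ (H k)
      = ∑' k : ℕ, ∑' n : ℕ, if n < k then μ (H k) else 0 := by
        refine tsum_congr fun k => ?_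
        rw [tsum_eq_sum (s := Finset.range k) fun n hn => if_neg (by simpa using hn),
          Finset.sum_congr rfl fun n hn => if_pos (Finset.mem_range.1 hn)]
        simp
    _ = ∑' n : ℕ, ∑' k : ℕ, if n < k then μ (H k) else 0 := ENNReal.tsum_comm
    _ ≤ _ := by
        refine ENNReal.tsum_le_tsum fun n => ?_
        calc ∑' k : ℕ, (if n < k then μ (H k) else 0)
            = ∑' k : ℕ, μ (if n < k then H k else ∅) := by
              refine tsum_congr fun k => ?_
              split_ifs <;> simp
          _ = μ (⋃ k, if n < k then H k else ∅) := by
              refine (measure_iUnion (fun i j hij => ?_) fun k => ?_).symm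
              · simp only [Function.onFun]
                split_ifs
                · exact hdisj hij
                all_goals simp
              · split_ifs
                · exact hHm k
                · exact .empty
          _ ≤ _ := by
              refine measure_mono (Set.iUnion_subset fun k => ?_)
              split_ifs with h
              · exact fun ω hω i hi => hω.2 i (by omega)
              · exact Set.empty_subset _

theorem measure_forall_pos_eq_zero (h : ∑' n, μ (stayPos L n) ≠ ⊤) :
    μ {ω | ∀ k, 0 < L k ω} = 0 :=
  le_antisymm (ge_of_tendsto' (ENNReal.tendsto_atTop_zero_of_tsum_ne_top h)
    fun _ => measure_mono fun _ hω i _ => hω i) zero_le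

end Hitting


/-- for the Markov chain `L` with kernel `Q(r,s) = P^r(0,s-r)` and
`τ₀ := min{k ≥ 0 : L(k) ≤ 0}`, for every `δ > 0` there is `K_δ < ∞` with
`E[τ₀ | L(0) = r] ≤ (2+δ) r + K_δ` for all `r ∈ ℕ`; in particular `τ₀ < ∞` a.s.
The expectation `E[τ₀]` is written as `∑_k k Pr(τ₀ = k) + ∞ · Pr(τ₀ = ∞)` in `ℝ≥0∞`. -/
theorem stmt_11 (w : ℤ → ℝ) (hw : GoodWeight w) :
    ∀ δ > (0 : ℝ), ∃ Kδ : ℝ, ∀ r : ℕ,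
      ∀ (Ω : Type) [MeasurableSpace Ω] (μ : Measure Ω) [IsProbabilityMeasure μ]
        (L : ℕ → Ω → ℤ), KChain μ (Qker w) L r →
        ((∑' k : ℕ, (k : ℝ≥0∞) * μ {ω | L k ω ≤ 0 ∧ ∀ i < k, 0 < L i ω}) +
            ⊤ * μ {ω | ∀ k, 0 < L k ω} ≤
          ENNReal.ofReal ((2 + δ) * r + Kδ)) ∧
        μ {ω | ∃ k, L k ω ≤ 0} = 1 := by
  intro δ hδ
  obtain ⟨G, hG, hGV⟩ := hw.exists_lyapunov hδ
  refine ⟨G.toReal, fun r Ω _ μ _ L hL => ?_⟩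
  have hV : ∀ x : ℤ, 0 < x →
      ∑' y, ENNReal.ofReal (Qker w x y) * lyapunov (ENNReal.ofReal (2 + δ)) G y + 1 ≤
        lyapunov (ENNReal.ofReal (2 + δ)) G x := by
    intro x hx
    lift x to ℕ using hx.le
    exact hGV x (by exact_mod_cast hx)
  have hsum := hL.tsum_stayPos_le hw.Qker_nonneg hV
  have hbound : lyapunov (ENNReal.ofReal (2 + δ)) G r ≤
      ENNReal.ofReal ((2 + δ) * r + G.toReal) := by
    rw [ENNReal.ofReal_add (by positivity) ENNReal.toReal_nonneg, ENNReal.ofReal_toReal hG,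
      ENNReal.ofReal_mul (by positivity), ENNReal.ofReal_natCast, lyapunov, Int.toNat_natCast]
    gcongr
    split_ifs <;> simp
  have hzero := measure_forall_pos_eq_zero
    (ne_top_of_le_ne_top ENNReal.ofReal_ne_top (hsum.trans hbound))
  refine ⟨?_, ?_⟩
  · rw [hzero, mul_zero, add_zero]
    exact (tsum_hitting_le hL.1).trans (hsum.trans hbound)
  · have hm : MeasurableSet {ω | ∀ k, 0 < L k ω} := by
      rw [Set.ofPred_forall]
      exact .iInter fun k => hL.1 k measurableSet_Ioi
    rw [show {ω | ∃ k, L k ω ≤ 0} = {ω | ∀ k, 0 < L k ω}ᶜ by ext; simp]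
    exact (prob_compl_eq_one_iff hm).2 hzero
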